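/- Let r₁,…,rₙ be distinct roots of the characteristic equation P(z)=0 with Re r_k < 0 for all 1 ≤ k ≤ n, and let K = (1/|V|)∫₀^∞ |Σ_{k=1}^n (−1)^k V_k e^{r_k x}| dx. Then for every ε > 0 and every y ∈ Cⁿ(ℝ,X) with ‖D(y)(t)‖ ≤ ε for all t ∈ ℝ, there exists y_H ∈ Ker D such that ‖y(t) − y_H(t)‖ ≤ Kε for all t ∈ ℝ. -/

import Mathlib

open MeasureTheory

/-- The linear differential operator `D(y) = y⁽ⁿ⁾ + a₁ y⁽ⁿ⁻¹⁾ + ⋯ + aₙ y`,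
where `a j` is the coefficient of `y⁽ⁿ⁻¹⁻ʲ⁾` (zero-based indexing). -/
noncomputable def Dop {X : Type*} [NormedAddCommGroup X] [NormedSpace ℂ X]
    (n : ℕ) (a : Fin n → ℂ) (y : ℝ → X) : ℝ → X :=
  fun t => iteratedDeriv n y t + ∑ j : Fin n, a j • iteratedDeriv (n - 1 - (j : ℕ)) y t

/-- Vandermonde determinant of `r₁, …, rₙ` with the `k`-th entry deleted. -/
noncomputable def VandDel {n : ℕ} (r : Fin (n + 1) → ℂ) (k : Fin (n + 1)) : ℂ :=
  (Matrix.vandermonde fun i : Fin n => r (k.succAbove i)).det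

/-- The alternating sum of reduced Vandermonde determinants against `r k ^ m` is the determinant of
the Vandermonde matrix whose last column is replaced by the `m`-th powers. -/
theorem sum_VandDel_mul_pow {n : ℕ} (r : Fin (n + 1) → ℂ) (m : ℕ) :
    ∑ k : Fin (n + 1), (-1 : ℂ) ^ ((k : ℕ) + n) * VandDel r k * r k ^ m =
      ((Matrix.vandermonde r).updateCol (Fin.last n) fun k => r k ^ m).det := by
  rw [Matrix.det_succ_column _ (Fin.last n)]
  refine Finset.sum_congr rfl fun k _ => ?_
  have hsub : ((Matrix.vandermonde r).updateCol (Fin.last n) fun k => r k ^ m).submatrix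
      k.succAbove (Fin.last n).succAbove =
      Matrix.vandermonde fun i : Fin n => r (k.succAbove i) := by
    ext i j
    simp [Matrix.vandermonde_apply, (Fin.castSucc_lt_last j).ne]
  rw [hsub, VandDel]
  simp only [Matrix.updateCol_self, Fin.val_last]
  ring

theorem sum_VandDel_mul_pow_of_lt {n : ℕ} (r : Fin (n + 1) → ℂ) {m : ℕ} (hm : m < n) :
    ∑ k : Fin (n + 1), (-1 : ℂ) ^ ((k : ℕ) + n) * VandDel r k * r k ^ m = 0 := by
  rw [sum_VandDel_mul_pow]
  have hne : (⟨m, by omega⟩ : Fin (n + 1)) ≠ Fin.last n := by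
    intro h
    have := congrArg Fin.val h
    simp at this
    omega
  refine Matrix.det_zero_of_column_eq hne fun i => ?_
  rw [Matrix.updateCol_ne hne, Matrix.updateCol_self, Matrix.vandermonde_apply]

theorem sum_VandDel_mul_pow_self {n : ℕ} (r : Fin (n + 1) → ℂ) :
    ∑ k : Fin (n + 1), (-1 : ℂ) ^ ((k : ℕ) + n) * VandDel r k * r k ^ n =
      (Matrix.vandermonde r).det := by
  rw [sum_VandDel_mul_pow]
  congr 1
  ext i j
  by_cases h : j = Fin.last n
  · subst h; simp [Matrix.vandermonde_apply]
  · rw [Matrix.updateCol_ne h]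

section Analysis

variable {X : Type*} [NormedAddCommGroup X] [NormedSpace ℂ X]

/-- A finite chain of derivatives computes the iterated derivatives of its first member. -/
theorem iteratedDeriv_eq_of_chain {g : ℕ → ℝ → X} {N : ℕ}
    (hg : ∀ m < N, ∀ t, HasDerivAt (g m) (g (m + 1) t) t) :
    ∀ m ≤ N, iteratedDeriv m (g 0) = g m := by
  intro m
  induction m with
  | zero => intro _; simp
  | succ m ih =>
    intro hm
    rw [iteratedDeriv_succ, ih (by omega)]
    exact funext fun t => (hg m hm t).deriv

theorem contDiff_of_chain {N : ℕ} : ∀ {g : ℕ → ℝ → X},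
    (∀ m < N, ∀ t, HasDerivAt (g m) (g (m + 1) t) t) → Continuous (g N) →
    ContDiff ℝ N (g 0) := by
  induction N with
  | zero => intro g _ hc; exact contDiff_zero.2 hc
  | succ N ih =>
    intro g hg hc
    rw [Nat.cast_succ, contDiff_succ_iff_deriv]
    refine ⟨fun t => (hg 0 N.succ_pos t).differentiableAt, by simp, ?_⟩
    rw [funext fun t => (hg 0 N.succ_pos t).deriv]
    exact ih (g := fun m => g (m + 1)) (fun m hm => hg (m + 1) (by omega)) hc

theorem integrableOn_Iic_exp_mul_sub_smul {c : ℂ} (hc : c.re < 0) {f : ℝ → X}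
    (hf : Continuous f) {ε : ℝ} (hb : ∀ s, ‖f s‖ ≤ ε) (t b : ℝ) :
    IntegrableOn (fun s : ℝ => Complex.exp (c * ((t - s : ℝ) : ℂ)) • f s) (Set.Iic b) := by
  have hexp : IntegrableOn (fun s : ℝ => Complex.exp (c * ((t - s : ℝ) : ℂ))) (Set.Iic b) := by
    have := (integrableOn_exp_mul_complex_Iic (a := -c) (by simpa using hc) b).const_mul
      (Complex.exp (c * t))
    refine this.congr (Filter.Eventually.of_forall fun s => ?_)
    simp only [← Complex.exp_add]
    congr 1
    push_cast
    ring
  exact hexp.smul_bdd ε hf.aestronglyMeasurable (Filter.Eventually.of_forall hb)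

/-- The bounded solution `∫_{-∞}^t e^{c (t - s)} f s ds` of the equation `u' = c u + f`. -/
noncomputable def expConv (c : ℂ) (f : ℝ → X) (t : ℝ) : X :=
  ∫ s in Set.Iic t, Complex.exp (c * ((t - s : ℝ) : ℂ)) • f s

theorem hasDerivAt_expConv [CompleteSpace X] {c : ℂ} (hc : c.re < 0) {f : ℝ → X}
    (hf : Continuous f) {ε : ℝ} (hb : ∀ s, ‖f s‖ ≤ ε) (t : ℝ) :
    HasDerivAt (expConv c f) (c • expConv c f t + f t) t := by
  set h : ℝ → X := fun s => Complex.exp (c * ((0 - s : ℝ) : ℂ)) • f s with hh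
  have hcont : Continuous h := by fun_prop
  have hint := integrableOn_Iic_exp_mul_sub_smul hc hf hb 0
  have heq : expConv c f = fun u : ℝ =>
      Complex.exp (c * u) • ((∫ s in Set.Iic 0, h s) + ∫ s in (0 : ℝ)..u, h s) := by
    funext u
    rw [← intervalIntegral.integral_Iic_sub_Iic (hint 0) (hint u), add_sub_cancel, expConv,
      ← integral_smul]
    refine integral_congr_ae (Filter.Eventually.of_forall fun s => ?_)
    simp only [smul_smul, ← Complex.exp_add]
    congr 2
    push_cast
    ring
  have hI : HasDerivAt (fun u : ℝ => (∫ s in Set.Iic 0, h s) + ∫ s in (0 : ℝ)..u, h s) (h t) t :=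
    (hcont.integral_hasStrictDerivAt 0 t).hasDerivAt.const_add _
  have hE : HasDerivAt (fun u : ℝ => Complex.exp (c * u)) (Complex.exp (c * t) * c) t := by
    simpa using ((Complex.ofRealCLM.hasDerivAt (x := t)).const_mul c).cexp
  rw [heq]
  refine (hE.smul hI).congr_deriv ?_
  have hexp : Complex.exp (c * t) • h t = f t := by
    simp [hh, smul_smul, ← Complex.exp_add]
  rw [hexp, smul_smul, mul_comm c (Complex.exp _), add_comm]

theorem setIntegral_Iic_comp_sub_left (g : ℝ → ℝ) (t : ℝ) :
    ∫ s in Set.Iic t, g (t - s) = ∫ x in Set.Ioi (0 : ℝ), g x := by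
  have := (Measure.measurePreserving_sub_left volume t).setIntegral_preimage_emb
    (MeasurableEquiv.subLeft t).measurableEmbedding g (Set.Ici (0 : ℝ))
  rw [← integral_Ici_eq_integral_Ioi, ← this]
  congr 2
  ext s
  simp

theorem norm_sum_smul_expConv_le {ι : Type*} [Fintype ι] {c r : ι → ℂ} (hr : ∀ k, (r k).re < 0)
    {f : ℝ → X} (hf : Continuous f) {ε : ℝ} (hb : ∀ s, ‖f s‖ ≤ ε) (t : ℝ) :
    ‖∑ k, c k • expConv (r k) f t‖ ≤
      (∫ x in Set.Ioi (0 : ℝ), ‖∑ k, c k * Complex.exp (r k * x)‖) * ε := by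
  have hsum : ∑ k, c k • expConv (r k) f t = ∫ s in Set.Iic t,
      (∑ k, c k * Complex.exp (r k * ((t - s : ℝ) : ℂ))) • f s := by
    simp only [expConv, ← integral_smul, Finset.sum_smul, mul_smul]
    exact (integral_finsetSum _ fun k _ =>
      (integrableOn_Iic_exp_mul_sub_smul (hr k) hf hb t t).smul (c k)).symm
  have hexp : IntegrableOn (fun s : ℝ => ∑ k, c k * Complex.exp (r k * ((t - s : ℝ) : ℂ)))
      (Set.Iic t) := by
    refine integrable_finsetSum _ fun k _ => Integrable.const_mul ?_ _
    simpa [IntegrableOn] using integrableOn_Iic_exp_mul_sub_smul (hr k)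
      (f := fun _ => (1 : ℂ)) continuous_const (ε := 1) (by simp) t t
  rw [hsum, ← setIntegral_Iic_comp_sub_left _ t, ← integral_mul_const]
  refine norm_integral_le_of_norm_le (hexp.norm.mul_const ε)
    (Filter.Eventually.of_forall fun s => ?_)
  rw [norm_smul]
  exact mul_le_mul_of_nonneg_left (hb s) (norm_nonneg _)

theorem continuous_Dop {n : ℕ} (a : Fin n → ℂ) {y : ℝ → X} (hy : ContDiff ℝ n y) :
    Continuous (Dop n a y) := by
  refine (hy.continuous_iteratedDeriv' n).add (continuous_finsetSum _ fun j _ => ?_)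
  exact (hy.continuous_iteratedDeriv _ (by exact_mod_cast (by omega))).const_smul (a j)

theorem Dop_sub {n : ℕ} (a : Fin n → ℂ) {y z : ℝ → X} (hy : ContDiff ℝ n y)
    (hz : ContDiff ℝ n z) : Dop n a (y - z) = Dop n a y - Dop n a z := by
  have key : ∀ m ≤ n, ∀ t,
      iteratedDeriv m (y - z) t = iteratedDeriv m y t - iteratedDeriv m z t := fun m hm t =>
    iteratedDeriv_sub (hy.of_le (by exact_mod_cast hm)).contDiffAt
      (hz.of_le (by exact_mod_cast hm)).contDiffAt
  funext t
  simp only [Dop, Pi.sub_apply]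
  rw [key n le_rfl, Finset.sum_congr rfl fun (j : Fin n) _ => by
    rw [key (n - 1 - j) (by omega), smul_sub], Finset.sum_sub_distrib]
  abel

/-- If `c` satisfies the moment conditions `∑ c k * r k ^ m = 0` for `m < n` and
`∑ c k * r k ^ n = 1`, then `∑ c k • expConv (r k) f` is a particular solution of `D y = f`. -/
theorem Dop_sum_smul_expConv [CompleteSpace X] {n : ℕ} {a r c : Fin (n + 1) → ℂ}
    (hroot : ∀ k, r k ^ (n + 1) + ∑ j : Fin (n + 1), a j * r k ^ (n - (j : ℕ)) = 0)
    (hr : ∀ k, (r k).re < 0) (hc : ∀ m < n, ∑ k, c k * r k ^ m = 0)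
    (hcn : ∑ k, c k * r k ^ n = 1) {f : ℝ → X} (hf : Continuous f) {ε : ℝ}
    (hb : ∀ s, ‖f s‖ ≤ ε) :
    ContDiff ℝ (n + 1 : ℕ) (fun t => ∑ k, c k • expConv (r k) f t) ∧
      Dop (n + 1) a (fun t => ∑ k, c k • expConv (r k) f t) = f := by
  set g : ℕ → ℝ → X := fun m t =>
    (∑ k, (c k * r k ^ m) • expConv (r k) f t) + if m = n + 1 then f t else 0 with hgdef
  have hsum : ∀ m t, HasDerivAt (fun t => ∑ k, (c k * r k ^ m) • expConv (r k) f t)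
      ((∑ k, (c k * r k ^ (m + 1)) • expConv (r k) f t) + (∑ k, c k * r k ^ m) • f t) t := by
    intro m t
    refine (HasDerivAt.fun_sum fun k (_ : k ∈ Finset.univ) =>
      (hasDerivAt_expConv (hr k) hf hb t).fun_const_smul (c k * r k ^ m)).congr_deriv ?_
    simp only [smul_add, Finset.sum_add_distrib, smul_smul, Finset.sum_smul, pow_succ, mul_assoc]
  have hg : ∀ m < n + 1, ∀ t, HasDerivAt (g m) (g (m + 1) t) t := by
    intro m hm t
    have h1 : g m = fun t => ∑ k, (c k * r k ^ m) • expConv (r k) f t := by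
      funext t; simp [hgdef, hm.ne]
    rw [h1]
    convert hsum m t using 1
    rcases Nat.lt_succ_iff_lt_or_eq.1 hm with h | h
    · simp [hgdef, hc m h, h.ne]
    · subst h; simp [hgdef, hcn]
  have hcont : Continuous (g (n + 1)) := by
    have : ∀ k, Continuous (expConv (r k) f) := fun k =>
      continuous_iff_continuousAt.2 fun t => (hasDerivAt_expConv (hr k) hf hb t).continuousAt
    simp only [hgdef, if_true]
    fun_prop
  have h0 : (fun t => ∑ k, c k • expConv (r k) f t) = g 0 := by
    funext t; simp [hgdef]
  rw [h0]
  refine ⟨contDiff_of_chain hg hcont, funext fun t => ?_⟩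
  have hD := iteratedDeriv_eq_of_chain hg
  rw [Dop, hD _ le_rfl, Finset.sum_congr rfl fun (j : Fin (n + 1)) _ => by
    rw [hD (n + 1 - 1 - j) (by omega)]]
  have hlow : ∀ j : Fin (n + 1), g (n + 1 - 1 - j) t =
      ∑ k, (c k * r k ^ (n - (j : ℕ))) • expConv (r k) f t := fun j => by
    have : n - (j : ℕ) ≠ n + 1 := by omega
    simp [hgdef, this]
  simp only [hlow]
  simp only [hgdef, if_true, Finset.smul_sum, smul_smul]
  rw [Finset.sum_comm, add_right_comm, ← Finset.sum_add_distrib]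
  simp only [← Finset.sum_smul, ← add_smul]
  rw [Finset.sum_eq_zero, zero_add]
  intro k _
  have : c k * r k ^ (n + 1) + ∑ j : Fin (n + 1), a j * (c k * r k ^ (n - (j : ℕ))) = 0 := by
    rw [← mul_zero (c k), ← hroot k, mul_add, Finset.mul_sum]
    simp only [mul_left_comm]
  rw [this, zero_smul]

end Analysis

theorem stmt1 {X : Type*} [NormedAddCommGroup X] [NormedSpace ℂ X] [CompleteSpace X]
    (n : ℕ) (a : Fin (n + 1) → ℂ) (r : Fin (n + 1) → ℂ)
    (hroot : ∀ k, r k ^ (n + 1) + ∑ j : Fin (n + 1), a j * r k ^ (n - (j : ℕ)) = 0)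
    (hinj : Function.Injective r)
    (hre : ∀ k, (r k).re < 0)
    (K : ℝ)
    (hK : K = (1 / ‖(Matrix.vandermonde r).det‖) *
      ∫ x in Set.Ioi (0 : ℝ), ‖∑ k : Fin (n + 1), (-1 : ℂ) ^ ((k : ℕ) + 1) *
        VandDel r k * Complex.exp (r k * x)‖)
    (ε : ℝ) (hε : 0 < ε)
    (y : ℝ → X) (hy : ContDiff ℝ (n + 1) y)
    (hbound : ∀ t : ℝ, ‖Dop (n + 1) a y t‖ ≤ ε) :
    ∃ yH : ℝ → X, ContDiff ℝ (n + 1) yH ∧ Dop (n + 1) a yH = 0 ∧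
      ∀ t : ℝ, ‖y t - yH t‖ ≤ K * ε := by
  set V := (Matrix.vandermonde r).det with hV
  have hV0 : V ≠ 0 := Matrix.det_vandermonde_ne_zero_iff.2 hinj
  have hy' : ContDiff ℝ (n + 1 : ℕ) y := by exact_mod_cast hy
  set c : Fin (n + 1) → ℂ := fun k => V⁻¹ * ((-1) ^ ((k : ℕ) + n) * VandDel r k) with hcdef
  have hmom : ∀ m, ∑ k, c k * r k ^ m =
      V⁻¹ * ∑ k : Fin (n + 1), (-1 : ℂ) ^ ((k : ℕ) + n) * VandDel r k * r k ^ m := fun m => by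
    simp only [hcdef, Finset.mul_sum, mul_assoc]
  obtain ⟨hp, hDp⟩ := Dop_sum_smul_expConv (c := c) hroot hre
    (fun m hm => by rw [hmom, sum_VandDel_mul_pow_of_lt r hm, mul_zero])
    (by rw [hmom, sum_VandDel_mul_pow_self, inv_mul_cancel₀ hV0])
    (continuous_Dop a hy') hbound
  refine ⟨y - fun t => ∑ k, c k • expConv (r k) (Dop (n + 1) a y) t,
    by exact_mod_cast hy'.sub hp, by rw [Dop_sub a hy' hp, hDp, sub_self], fun t => ?_⟩
  rw [Pi.sub_apply, sub_sub_cancel]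
  refine (norm_sum_smul_expConv_le hre (continuous_Dop a hy') hbound t).trans_eq ?_
  rw [hK, ← integral_const_mul]
  congr 2
  funext x
  have hfac : ∑ k, c k * Complex.exp (r k * x) = V⁻¹ * (-1) ^ (n + 1) *
      ∑ k : Fin (n + 1), (-1 : ℂ) ^ ((k : ℕ) + 1) * VandDel r k * Complex.exp (r k * x) := by
    rw [Finset.mul_sum]
    refine Finset.sum_congr rfl fun k _ => ?_
    simp only [hcdef, pow_add]
    ring
  rw [hfac, norm_mul, norm_mul]
  simp
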